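/- arXiv:1810.04980 — 2 statements merged into one kernel-verified Lean document; each statement's English description precedes it below -/
import Mathlib

section
/- If G is a complete graph on n vertices with n ≥ k ≥ 6 whose edges are colored with exactly t_{n,k−2} + 1 distinct colors and G does not contain a rainbow K_k, then G contains a spanning rainbow copy of the Turán graph T_{n,k−2} as a subgraph. -/
/-- `s` spans a rainbow clique in the edge-colored graph `(G, col)`:
`s` is a clique and distinct edges inside `s` receive distinct colors. -/
def IsRainbowClique {V : Type*} (G : SimpleGraph V) (col : Sym2 V → ℕ)
    (s : Finset V) : Prop :=
  G.IsClique s ∧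
    ∀ a ∈ s, ∀ b ∈ s, ∀ c ∈ s, ∀ d ∈ s, a ≠ b → c ≠ d →
      s(a, b) ≠ s(c, d) → col s(a, b) ≠ col s(c, d)

/-- `t_{n,r}`: the number of edges of the Turán graph `T_{n,r}`. -/
noncomputable def turanEdges (n r : ℕ) : ℕ :=
  (SimpleGraph.turanGraph n r).edgeSet.ncard

/-- The edge set of the copy of the Turán graph `T_{n,r}` on `Fin n` obtained by
relabelling the vertices of `SimpleGraph.turanGraph n r` along the
permutation `σ`. -/
def turanCopyEdges (n r : ℕ) (σ : Fin n ≃ Fin n) : Set (Sym2 (Fin n)) :=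
  {e | e.map σ ∈ (SimpleGraph.turanGraph n r).edgeSet}

section RainbowTuran

open Finset

variable {V : Type*} [DecidableEq V] {col : Sym2 V → ℕ} {H : SimpleGraph V} {r : ℕ}

/-- All pairs of distinct elements of `K` receive distinct colors. -/
def RainbowSet (col : Sym2 V → ℕ) (K : Finset V) : Prop :=
  ∀ a ∈ K, ∀ b ∈ K, ∀ c ∈ K, ∀ d ∈ K, a ≠ b → c ≠ d → col s(a, b) = col s(c, d) →
    s(a, b) = s(c, d)

/-- The color of the pair `e` is not used on the edges of `H`. -/
def FreshColor (col : Sym2 V → ℕ) (H : SimpleGraph V) (e : Sym2 V) : Prop :=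
  ∀ a b, H.Adj a b → col s(a, b) ≠ col e

/-- The complete multipartite graph on `S` whose parts are the fibers of `p`. -/
def multipartite (p : V → Fin r) (S : Finset V) : SimpleGraph V where
  Adj a b := a ∈ S ∧ b ∈ S ∧ p a ≠ p b
  symm := ⟨fun _ _ h => ⟨h.2.1, h.1, h.2.2.symm⟩⟩
  loopless := ⟨fun _ h => h.2.2 rfl⟩

omit [DecidableEq V] in
lemma eq_of_col_eq (hH : Set.InjOn col H.edgeSet) {a b c d : V} (hab : H.Adj a b)
    (hcd : H.Adj c d) (h : col s(a, b) = col s(c, d)) : s(a, b) = s(c, d) :=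
  hH (H.mem_edgeSet.2 hab) (H.mem_edgeSet.2 hcd) h

omit [DecidableEq V] in
lemma rainbowSet_of_adj_or (hH : Set.InjOn col H.edgeSet) {K : Finset V} {e₁ e₂ : Sym2 V}
    (hK : ∀ a ∈ K, ∀ b ∈ K, a ≠ b → H.Adj a b ∨ s(a, b) = e₁ ∨ s(a, b) = e₂)
    (h₁ : ∀ a ∈ K, ∀ b ∈ K, H.Adj a b → col s(a, b) ≠ col e₁)
    (h₂ : ∀ a ∈ K, ∀ b ∈ K, H.Adj a b → col s(a, b) ≠ col e₂)
    (h : col e₁ = col e₂ → e₁ = e₂) : RainbowSet col K := by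
  intro a ha b hb c hc d hd hab hcd heq
  have A := h₁ a ha b hb
  have A' := h₂ a ha b hb
  have C := h₁ c hc d hd
  have C' := h₂ c hc d hd
  rcases hK a ha b hb hab with h1 | h1 | h1 <;> rcases hK c hc d hd hcd with h2 | h2 | h2
  · exact eq_of_col_eq hH h1 h2 heq
  · exact absurd (h2 ▸ heq) (A h1)
  · exact absurd (h2 ▸ heq) (A' h1)
  · exact absurd (h1 ▸ heq.symm) (C h2)
  · rw [h1, h2]
  · rw [h1, h2] at heq ⊢; exact h heq
  · exact absurd (h1 ▸ heq.symm) (C' h2)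
  · rw [h1, h2] at heq ⊢; exact (h heq.symm).symm
  · rw [h1, h2]

lemma card_insert_union_image {p : V → Fin r} {v : V} {B : Finset V} {I : Finset (Fin r)}
    {t : Fin r → V} (hvB : v ∉ B) (hvt : ∀ i ∈ I, t i ≠ v) (ht : ∀ i ∈ I, p (t i) = i)
    (hB : ∀ b ∈ B, p b ∉ I) : #(insert v (B ∪ I.image t)) = #B + #I + 1 := by
  rw [card_insert_of_notMem, card_union_of_disjoint, card_image_of_injOn]
  · intro i hi j hj hij
    rw [← ht i hi, ← ht j hj, hij]
  · rw [disjoint_left]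
    intro b hb hb'
    obtain ⟨i, hi, rfl⟩ := mem_image.1 hb'
    exact hB _ hb (by rwa [ht i hi])
  · simp only [mem_union, mem_image, not_or, not_exists, not_and]
    exact ⟨hvB, hvt⟩

/-- Suppose `v` is joined in the rainbow graph `H` to a set `N` meeting all the parts of a complete
multipartite graph. If `x` and `y` are in `N` and in the same part, then in the absence of a rainbow
`K_{r + 2}` the color of `xy` is also the color of an edge of `H` both of whose ends belong to every
clique consisting of `v`, `x`, `y` and a transversal of the other parts in `N`. -/
lemma exists_adj_col_eq (hH : Set.InjOn col H.edgeSet)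
    (hno : ∀ K : Finset V, #K = r + 2 → ¬ RainbowSet col K) {p : V → Fin r} {N : Finset V} {v : V}
    (hT : ∀ a ∈ N, ∀ b ∈ N, p a ≠ p b → H.Adj a b) (hv : ∀ a ∈ N, H.Adj v a)
    (hN : ∀ i, ∃ a ∈ N, p a = i) {x y : V} (hx : x ∈ N) (hy : y ∈ N) (hxy : x ≠ y)
    (hpxy : p x = p y) :
    ∃ a b, H.Adj a b ∧ col s(a, b) = col s(x, y) ∧ ∀ c ∈ s(a, b),
      c = v ∨ c = x ∨ c = y ∨ c ∈ N ∧ ∀ d ∈ N, p d = p c → d = c := by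
  have hvN : v ∉ N := fun h => (hv v h).ne rfl
  let K (t : Fin r → V) : Finset V := insert v ({x, y} ∪ (univ.erase (p x)).image t)
  have key : ∀ t : Fin r → V, (∀ i, t i ∈ N ∧ p (t i) = i) →
      ∃ a ∈ K t, ∃ b ∈ K t, H.Adj a b ∧ col s(a, b) = col s(x, y) := by
    intro t ht
    by_contra! hcon
    refine hno (K t) ?_ (rainbowSet_of_adj_or hH (e₁ := s(x, y)) (e₂ := s(x, y)) ?_ hcon hcon
      fun _ => rfl)
    · rw [card_insert_union_image (p := p)]
      · rw [card_pair hxy, card_erase_of_mem (mem_univ _), card_univ, Fintype.card_fin]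
        have := (p x).pos
        omega
      · simp only [mem_insert, mem_singleton, not_or]
        exact ⟨fun h => hvN (h ▸ hx), fun h => hvN (h ▸ hy)⟩
      · exact fun i _ h => hvN (h ▸ (ht i).1)
      · exact fun i _ => (ht i).2
      · simp [hpxy]
    · have hmem : ∀ a ∈ K t, a = v ∨ a ∈ N ∧ (a = x ∨ a = y ∨ p a ≠ p x ∧ t (p a) = a) := by
        intro a ha
        simp only [K, mem_insert, mem_union, mem_singleton, mem_image, mem_erase, mem_univ,
          and_true] at ha
        rcases ha with rfl | (rfl | rfl) | ⟨i, hi, rfl⟩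
        · exact Or.inl rfl
        · exact Or.inr ⟨hx, Or.inl rfl⟩
        · exact Or.inr ⟨hy, Or.inr (Or.inl rfl)⟩
        · refine Or.inr ⟨(ht i).1, Or.inr (Or.inr ?_)⟩
          rw [(ht i).2]
          exact ⟨hi, rfl⟩
      intro a ha b hb hab
      rcases hmem a ha with rfl | ⟨haN, ha'⟩
      · rcases hmem b hb with rfl | ⟨hbN, -⟩
        · exact absurd rfl hab
        · exact Or.inl (hv b hbN)
      rcases hmem b hb with rfl | ⟨hbN, hb'⟩
      · exact Or.inl (hv a haN).symm
      by_cases hp : p a = p b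
      · right; left
        rcases ha' with rfl | rfl | ⟨h1, h2⟩ <;> rcases hb' with rfl | rfl | ⟨h3, h4⟩
        · exact absurd rfl hab
        · rfl
        · exact absurd hp.symm h3
        · exact Sym2.eq_swap
        · exact absurd rfl hab
        · exact absurd (hp.symm.trans hpxy.symm) h3
        · exact absurd hp h1
        · exact absurd (hp.trans hpxy.symm) h1
        · exact absurd (h2.symm.trans ((congrArg t hp).trans h4)) hab
      · exact Or.inl (hT a haN b hbN hp)
  choose t htN htp using hN
  obtain ⟨a, ha, b, hb, hab, hcol⟩ := key t fun i => ⟨htN i, htp i⟩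
  refine ⟨a, b, hab, hcol, fun c hc => ?_⟩
  have hcK : c ∈ K t := by rcases Sym2.mem_iff.1 hc with rfl | rfl <;> assumption
  by_contra! hcon
  obtain ⟨hcv, hcx, hcy, hcN⟩ := hcon
  have hcN' : c ∈ N := by
    simp only [K, mem_insert, mem_union, mem_singleton, mem_image, hcv, hcx, hcy, false_or] at hcK
    obtain ⟨i, -, rfl⟩ := hcK
    exact htN i
  obtain ⟨d, hdN, hdp, hdc⟩ := hcN hcN'
  obtain ⟨a', ha', b', hb', hab', hcol'⟩ := key (Function.update t (p c) d) fun i => by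
    by_cases hi : i = p c
    · subst hi; simp [hdN, hdp]
    · simp [hi, htN, htp]
  rw [eq_of_col_eq hH hab hab' (hcol.trans hcol'.symm)] at hc
  have hcK' : c ∈ K (Function.update t (p c) d) := by
    rcases Sym2.mem_iff.1 hc with rfl | rfl <;> assumption
  simp only [K, mem_insert, mem_union, mem_singleton, mem_image, hcv, hcx, hcy, false_or] at hcK'
  obtain ⟨i, -, hi⟩ := hcK'
  by_cases hic : i = p c
  · rw [hic, Function.update_self] at hi
    exact hdc hi
  · rw [Function.update_of_ne hic] at hi
    exact hic (by rw [← hi, htp])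

/-- Two pairs inside different parts, with colors of edges of `H` at a common vertex `w`, extend to
a rainbow clique avoiding the part `j` of `w`. -/
lemma exists_rainbowSet_of_common_vertex (hH : Set.InjOn col H.edgeSet) {p : V → Fin r}
    {N : Finset V} {v w : V} {j : Fin r} (hT : ∀ a ∈ N, ∀ b ∈ N, p a ≠ p b → H.Adj a b)
    (hv : ∀ a ∈ N, H.Adj v a) (hN : ∀ i ≠ j, ∃ a ∈ N, p a = i) (hwv : w ≠ v)
    (hwN : w ∈ N → p w = j) {x y x' y' : V} (hx : x ∈ N) (hy : y ∈ N) (hx' : x' ∈ N)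
    (hy' : y' ∈ N) (hxy : x ≠ y) (hxy' : x' ≠ y') (hp : p x = p y) (hp' : p x' = p y')
    (hpp : p x ≠ p x') (hj : p x ≠ j) (hj' : p x' ≠ j)
    (hc : ∃ z, (z = x ∨ z = y) ∧ H.Adj z w ∧ col s(x, y) = col s(z, w))
    (hc' : ∃ z, (z = x' ∨ z = y') ∧ H.Adj z w ∧ col s(x', y') = col s(z, w)) :
    ∃ K : Finset V, #K = r + 2 ∧ RainbowSet col K := by
  have hvN : v ∉ N := fun h => (hv v h).ne rfl
  have hN' : ∀ i, ∃ a, i ≠ j → a ∈ N ∧ p a = i := fun i => by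
    by_cases hi : i = j
    · exact ⟨v, fun h => absurd hi h⟩
    · obtain ⟨a, ha⟩ := hN i hi
      exact ⟨a, fun _ => ha⟩
  choose t ht using hN'
  set I : Finset (Fin r) := univ \ {p x, p x', j} with hI
  have hI' : ∀ i ∈ I, i ≠ p x ∧ i ≠ p x' ∧ i ≠ j := fun i hi => by
    simpa [hI, not_or] using hi
  set K : Finset V := insert v ({x, y, x', y'} ∪ I.image t) with hK
  have hmem : ∀ a ∈ K, a = v ∨ a ∈ N ∧ p a ≠ j ∧ (p a = p x ∧ (a = x ∨ a = y) ∨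
      p a = p x' ∧ (a = x' ∨ a = y') ∨ p a ≠ p x ∧ p a ≠ p x' ∧ t (p a) = a) := by
    intro a ha
    simp only [K, mem_insert, mem_union, mem_singleton, mem_image] at ha
    rcases ha with rfl | (rfl | rfl | rfl | rfl) | ⟨i, hi, rfl⟩
    · exact Or.inl rfl
    · exact Or.inr ⟨hx, hj, Or.inl ⟨rfl, Or.inl rfl⟩⟩
    · exact Or.inr ⟨hy, hp ▸ hj, Or.inl ⟨hp.symm, Or.inr rfl⟩⟩
    · exact Or.inr ⟨hx', hj', Or.inr (Or.inl ⟨rfl, Or.inl rfl⟩)⟩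
    · exact Or.inr ⟨hy', hp' ▸ hj', Or.inr (Or.inl ⟨hp'.symm, Or.inr rfl⟩)⟩
    · obtain ⟨h1, h2, h3⟩ := hI' i hi
      have h4 := ht i h3
      refine Or.inr ⟨h4.1, ?_⟩
      rw [h4.2]
      exact ⟨h3, by simp [h1, h2]⟩
  have hwK : w ∉ K := fun h => by
    rcases hmem w h with h | ⟨h1, h2, -⟩
    · exact hwv h
    · exact h2 (hwN h1)
  obtain ⟨z, hz, hzw, hcz⟩ := hc
  obtain ⟨z', hz', hzw', hcz'⟩ := hc'
  refine ⟨K, ?_, rainbowSet_of_adj_or hH (e₁ := s(x, y)) (e₂ := s(x', y')) ?_ ?_ ?_ ?_⟩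
  · have h1 : x ≠ x' := fun h => hpp (h ▸ rfl)
    have h2 : x ≠ y' := fun h => hpp (hp' ▸ h ▸ rfl)
    have h3 : y ≠ x' := fun h => hpp (hp ▸ h ▸ rfl)
    have h4 : y ≠ y' := fun h => hpp (hp.trans (h ▸ hp'.symm))
    rw [card_insert_union_image (p := p)]
    · have h5 : #({x, y, x', y'} : Finset V) = 4 := by
        rw [card_insert_of_notMem, card_insert_of_notMem, card_pair hxy'] <;> simp [*]
      have h6 : #I + 3 = r := by
        have h7 : #({p x, p x', j} : Finset (Fin r)) = 3 := by
          rw [card_insert_of_notMem, card_pair hj']; simp [hpp, hj]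
        have h8 := card_sdiff_add_card_eq_card (subset_univ ({p x, p x', j} : Finset (Fin r)))
        rw [h7, card_univ, Fintype.card_fin] at h8
        exact h8
      omega
    · simp only [mem_insert, mem_singleton, not_or]
      exact ⟨fun h => hvN (h ▸ hx), fun h => hvN (h ▸ hy), fun h => hvN (h ▸ hx'),
        fun h => hvN (h ▸ hy')⟩
    · exact fun i hi h => hvN (h ▸ (ht i (hI' i hi).2.2).1)
    · exact fun i hi => (ht i (hI' i hi).2.2).2
    · simp [hI, ← hp, ← hp']
  · intro a ha b hb hab
    rcases hmem a ha with rfl | ⟨haN, -, ha'⟩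
    · rcases hmem b hb with rfl | ⟨hbN, -⟩
      · exact absurd rfl hab
      · exact Or.inl (hv b hbN)
    rcases hmem b hb with rfl | ⟨hbN, -, hb'⟩
    · exact Or.inl (hv a haN).symm
    by_cases hpab : p a = p b
    · right
      rcases ha' with ⟨h1, h2⟩ | ⟨h1, h2⟩ | ⟨h1, h2, h3⟩ <;>
        rcases hb' with ⟨h4, h5⟩ | ⟨h4, h5⟩ | ⟨h4, h5, h6⟩
      · left
        rcases h2 with rfl | rfl <;> rcases h5 with rfl | rfl <;>
          first | exact absurd rfl hab | rfl | exact Sym2.eq_swap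
      · exact absurd (h1.symm.trans (hpab.trans h4)) hpp
      · exact absurd (hpab.symm.trans h1) h4
      · exact absurd (h4.symm.trans (hpab.symm.trans h1)) hpp
      · right
        rcases h2 with rfl | rfl <;> rcases h5 with rfl | rfl <;>
          first | exact absurd rfl hab | rfl | exact Sym2.eq_swap
      · exact absurd (hpab.symm.trans h1) h5
      · exact absurd (hpab.trans h4) h1
      · exact absurd (hpab.trans h4) h2
      · exact absurd (h3.symm.trans ((congrArg t hpab).trans h6)) hab
    · exact Or.inl (hT a haN b hbN hpab)
  · intro a ha b hb hab heq
    have h1 := eq_of_col_eq hH hab hzw (heq.trans hcz)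
    have h2 : w ∈ s(a, b) := h1 ▸ Sym2.mem_mk_right z w
    rcases Sym2.mem_iff.1 h2 with rfl | rfl <;> exact hwK ‹_›
  · intro a ha b hb hab heq
    have h1 := eq_of_col_eq hH hab hzw' (heq.trans hcz')
    have h2 : w ∈ s(a, b) := h1 ▸ Sym2.mem_mk_right z' w
    rcases Sym2.mem_iff.1 h2 with rfl | rfl <;> exact hwK ‹_›
  · intro heq
    exfalso
    have h1 := eq_of_col_eq hH hzw hzw' (hcz.symm.trans (heq.trans hcz'))
    rw [Sym2.congr_left] at h1
    subst h1
    exact hpp (by rcases hz with h | h <;> rcases hz' with h' | h' <;>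
      simp only [hp, hp', ← h, ← h'])

/-- The size of the part `i` of `S` with respect to `p`. -/
def partSize (p : V → Fin r) (S : Finset V) (i : Fin r) : ℕ := #{u ∈ S | p u = i}

/-- The parts of `S` with respect to `p` have sizes as equal as possible. -/
def EquipartitionOn (p : V → Fin r) (S : Finset V) : Prop :=
  ∀ i j, partSize p S i ≤ partSize p S j + 1

omit [DecidableEq V] in
lemma sum_partSize (p : V → Fin r) (S : Finset V) : ∑ i, partSize p S i = #S :=
  (card_eq_sum_card_fiberwise fun _ _ => mem_coe.2 (mem_univ _)).symm

omit [DecidableEq V] in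
lemma EquipartitionOn.exists_eq_div {p : V → Fin r} {S : Finset V} (h : EquipartitionOn p S)
    (hr : 0 < r) :
    ∃ i, partSize p S i = #S / r := by
  have : NeZero r := ⟨hr.ne'⟩
  obtain ⟨i, -, hi⟩ := exists_min_image univ (partSize p S) univ_nonempty
  refine ⟨i, (Nat.div_eq_of_lt_le ?_ ?_).symm⟩
  · rw [← sum_partSize p S, mul_comm]
    simpa using card_nsmul_le_sum univ (partSize p S) _ hi
  · rw [← sum_partSize p S]
    have h1 : ∑ j, partSize p S j < ∑ _j : Fin r, (partSize p S i + 1) :=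
      sum_lt_sum (fun j _ => h j i) ⟨i, mem_univ i, Nat.lt_succ_self _⟩
    simpa [mul_comm] using h1

omit [DecidableEq V] in
lemma EquipartitionOn.div_le {p : V → Fin r} {S : Finset V} (h : EquipartitionOn p S) (i : Fin r) :
    #S / r ≤ partSize p S i := by
  by_contra! hi
  have h1 : ∑ j, partSize p S j < ∑ _j : Fin r, (#S / r) := by
    refine sum_lt_sum (fun j _ => ?_) ⟨i, mem_univ i, hi⟩
    have := h j i
    omega
  rw [sum_partSize] at h1
  simp only [sum_const, card_univ, Fintype.card_fin, smul_eq_mul] at h1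
  have := Nat.mul_div_le #S r
  omega

omit [DecidableEq V] in
lemma EquipartitionOn.le_div {p : V → Fin r} {S : Finset V} (h : EquipartitionOn p S) (i : Fin r) :
    partSize p S i ≤ #S / r + 1 := by
  obtain ⟨j, hj⟩ := h.exists_eq_div i.pos
  exact hj ▸ h i j

lemma partSize_update_insert {p : V → Fin r} {S : Finset V} {v : V} (hv : v ∉ S) (i j : Fin r) :
    partSize (Function.update p v i) (insert v S) j = partSize p S j + if i = j then 1 else 0 := by
  have h : {u ∈ S | Function.update p v i u = j} = {u ∈ S | p u = j} :=
    filter_congr fun u hu => by rw [Function.update_of_ne (ne_of_mem_of_not_mem hu hv)]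
  rw [partSize, filter_insert, Function.update_self, h]
  split_ifs with hij
  · rw [card_insert_of_notMem (fun h' => hv (mem_filter.1 h').1)]
    rfl
  · rfl

lemma EquipartitionOn.update_insert {p : V → Fin r} {S : Finset V} (h : EquipartitionOn p S) {v : V}
    (hv : v ∉ S) {i : Fin r} (hi : partSize p S i = #S / r) :
    EquipartitionOn (Function.update p v i) (insert v S) := by
  intro j k
  rw [partSize_update_insert hv, partSize_update_insert hv]
  have h1 := h.le_div j
  have h2 := h.div_le k
  have h3 := h j k
  split_ifs with hj hk
  · omega
  · subst hj; omega
  · omega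
  · omega

omit [DecidableEq V] in
lemma EquipartitionOn.comp_perm {p : V → Fin r} {S : Finset V} (h : EquipartitionOn p S)
    (σ : Equiv.Perm V)
    (hσ : ∀ u, σ u ∈ S ↔ u ∈ S) : EquipartitionOn (p ∘ σ) S := by
  have key : ∀ i, partSize (p ∘ σ) S i = partSize p S i := fun i =>
    card_bij (fun u _ => σ u) (fun u hu => by simpa [hσ] using hu)
      (fun _ _ _ _ h => σ.injective h)
      fun u hu => ⟨σ.symm u, by simpa [← hσ (σ.symm u)] using hu, by simp⟩
  intro i j
  rw [key, key]
  exact h i j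

lemma exists_balanced (hr : 0 < r) (S : Finset V) : ∃ p : V → Fin r, EquipartitionOn p S := by
  induction S using Finset.induction_on with
  | empty => exact ⟨fun _ => ⟨0, hr⟩, fun i j => by simp [partSize]⟩
  | insert v S hv ih =>
    obtain ⟨p, hp⟩ := ih
    obtain ⟨i, hi⟩ := hp.exists_eq_div hr
    exact ⟨_, hp.update_insert hv hi⟩

lemma turanEdges_eq_card (n r : ℕ) : turanEdges n r = #(SimpleGraph.turanGraph n r).edgeFinset := by
  rw [turanEdges, ← SimpleGraph.coe_edgeFinset, Set.ncard_coe_finset]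

lemma two_mul_turanEdges (r q b : ℕ) (hb : b ≤ r + 1) :
    2 * (turanEdges (q * (r + 1) + b) (r + 1) : ℤ) =
      (q ^ 2 * (r + 1) + 2 * q * b) * r + b * (b - 1) := by
  induction q with
  | zero =>
    rw [turanEdges_eq_card]
    have h1 : SimpleGraph.turanGraph (0 * (r + 1) + b) (r + 1) = ⊤ :=
      SimpleGraph.turanGraph_eq_top.2 (by omega)
    have h2 : #(SimpleGraph.turanGraph (0 * (r + 1) + b) (r + 1)).edgeFinset = b.choose 2 := by
      have := SimpleGraph.card_edgeFinset_top_eq_card_choose_two (V := Fin (0 * (r + 1) + b))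
      simp only [Fintype.card_fin, zero_mul, zero_add] at this ⊢
      rw [← this]
      congr!
    rw [h2]
    have h3 : b.choose 2 * 2 = b * (b - 1) := by
      rw [Nat.choose_two_right, Nat.div_mul_cancel (Nat.even_mul_pred_self b).two_dvd]
    have h4 : ((b * (b - 1) : ℕ) : ℤ) = (b : ℤ) * (b - 1) := by
      cases b <;> simp
    have h5 : ((b.choose 2 * 2 : ℕ) : ℤ) = (b : ℤ) * (b - 1) := by rw [h3, h4]
    push_cast at h5 ⊢
    linarith
  | succ q ih =>
    have h1 : (q + 1) * (r + 1) + b = q * (r + 1) + b + (r + 1) := by ring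
    have h2 : (r + 1).choose 2 * 2 = (r + 1) * r := by
      rw [Nat.choose_two_right, Nat.div_mul_cancel (Nat.even_mul_pred_self _).two_dvd]
      rfl
    have h3 : (((r + 1).choose 2 * 2 : ℕ) : ℤ) = ((r + 1) * r : ℕ) := by rw [h2]
    rw [turanEdges_eq_card] at ih ⊢
    rw [h1, SimpleGraph.card_edgeFinset_turanGraph_add]
    push_cast at h3 ih ⊢
    linarith

lemma turanEdges_succ (n : ℕ) {r : ℕ} (hr : 0 < r) :
    turanEdges (n + 1) r = turanEdges n r + (n - n / r) := by
  obtain ⟨r, rfl⟩ := Nat.exists_eq_add_one.2 hr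
  have hn := Nat.div_add_mod n (r + 1)
  have hb := Nat.mod_lt n hr
  set q := n / (r + 1)
  set b := n % (r + 1)
  have h1 := two_mul_turanEdges r q b hb.le
  have h2 := two_mul_turanEdges r q (b + 1) hb
  rw [show q * (r + 1) + b = n by rw [mul_comm, hn]] at h1
  rw [show q * (r + 1) + (b + 1) = n + 1 by rw [← add_assoc, mul_comm, hn]] at h2
  have h3 : q ≤ n := Nat.div_le_self _ _
  zify [h3]
  push_cast at h1 h2
  have h4 : (n : ℤ) = (r + 1) * q + b := by exact_mod_cast hn.symm
  rw [h4]
  linarith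

/-- Adding a vertex to a Turán graph on at least `r + 1` vertices, the sum of the degrees stays well
below that of a graph of minimum degree larger than in the Turán graph. -/
lemma two_mul_turanEdges_add_two_lt {n r : ℕ} (hr : 0 < r) (hn : r + 1 ≤ n) :
    2 * (turanEdges (n + 1) r + 1) < (n + 1) * (n - n / r + 1) := by
  obtain ⟨r, rfl⟩ := Nat.exists_eq_add_one.2 hr
  have hd := Nat.div_add_mod n (r + 1)
  have hb := Nat.mod_lt n hr
  have hq : 1 ≤ n / (r + 1) := (Nat.one_le_div_iff hr).2 (by omega)
  have hqb : 1 < n / (r + 1) ∨ 1 ≤ n % (r + 1) := by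
    by_contra! h
    rw [show n / (r + 1) = 1 by omega, show n % (r + 1) = 0 by omega] at hd
    omega
  set q := n / (r + 1)
  set b := n % (r + 1)
  have h2 := two_mul_turanEdges r q (b + 1) hb
  rw [show q * (r + 1) + (b + 1) = n + 1 by rw [← add_assoc, mul_comm, hd]] at h2
  have h3 : q ≤ n := Nat.div_le_self _ _
  zify [h3]
  push_cast at h2
  have h4 : (n : ℤ) = (r + 1) * q + b := by exact_mod_cast hd.symm
  rw [h4]
  have h5 : (2 : ℤ) < (b + 1) * (q + 1) := by
    norm_cast
    rcases hqb with h | h <;> nlinarith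
  nlinarith

/-- The colors used on the pairs in `S`. -/
def colorsOn (col : Sym2 V → ℕ) (S : Finset V) : Finset ℕ :=
  S.offDiag.image fun x => col s(x.1, x.2)

omit [DecidableEq V] in
lemma mem_colorsOn {S : Finset V} {c : ℕ} :
    c ∈ colorsOn col S ↔ ∃ a ∈ S, ∃ b ∈ S, a ≠ b ∧ col s(a, b) = c := by
  simp [colorsOn, mem_offDiag, and_assoc]

omit [DecidableEq V] in
lemma colorsOn_mono {S T : Finset V} (h : S ⊆ T) : colorsOn col S ⊆ colorsOn col T :=
  image_subset_image (offDiag_mono h)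

/-- Every color is lost on the deletion of at most two different vertices. -/
lemma sum_card_colorsOn_sdiff_le (S : Finset V) :
    ∑ v ∈ S, #(colorsOn col S \ colorsOn col (S.erase v)) ≤ 2 * #(colorsOn col S) := by
  have h1 : ∀ v, colorsOn col S \ colorsOn col (S.erase v) =
      bipartiteAbove (fun v c => c ∉ colorsOn col (S.erase v)) (colorsOn col S) v := fun v => by
    ext c; simp [bipartiteAbove]
  simp_rw [h1]
  rw [sum_card_bipartiteAbove_eq_sum_card_bipartiteBelow, mul_comm, ← smul_eq_mul]
  refine sum_le_card_nsmul _ _ _ fun c hc => ?_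
  obtain ⟨a, ha, b, hb, hab, rfl⟩ := mem_colorsOn.1 hc
  refine (card_le_card fun v hv => ?_).trans (card_le_two (a := a) (b := b))
  simp only [bipartiteBelow, mem_filter] at hv
  by_contra! hvab
  simp only [mem_insert, mem_singleton, not_or] at hvab
  exact hv.2 (mem_colorsOn.2 ⟨a, mem_erase.2 ⟨Ne.symm hvab.1, ha⟩, b,
    mem_erase.2 ⟨Ne.symm hvab.2, hb⟩, hab, rfl⟩)

lemma exists_card_colorsOn_sdiff_le {n : ℕ} {S : Finset V} (hr : 0 < r) (hn : r + 1 ≤ n)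
    (hS : #S = n + 1) (hc : #(colorsOn col S) = turanEdges (n + 1) r + 1) :
    ∃ v ∈ S, #(colorsOn col S \ colorsOn col (S.erase v)) ≤ n - n / r := by
  by_contra! hcon
  have h1 := card_nsmul_le_sum S (fun v => #(colorsOn col S \ colorsOn col (S.erase v)))
    (n - n / r + 1) hcon
  rw [hS, smul_eq_mul] at h1
  have h2 := sum_card_colorsOn_sdiff_le (col := col) S
  have h3 := two_mul_turanEdges_add_two_lt hr hn
  rw [hc] at h2
  omega

omit [DecidableEq V] in
/-- The number of colors on a complete multipartite graph is at most the number of edges of the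
Turán graph. -/
lemma card_colors_multipartite_le (p : V → Fin r) (S : Finset V) (X : Finset ℕ)
    (hX : ∀ c ∈ X, ∃ a b, (multipartite p S).Adj a b ∧ col s(a, b) = c) :
    #X ≤ turanEdges #S r := by
  classical
  let G : SimpleGraph S := (⊤ : SimpleGraph (Fin r)).comap fun u => p u
  have h1 : G.CliqueFree (r + 1) := by
    refine SimpleGraph.Colorable.cliqueFree (n := r) ?_ (Nat.lt_succ_self r)
    simpa using (SimpleGraph.Coloring.mk (fun u : S => p u) fun {a b} h => h : G.Coloring
      (Fin r)).colorable
  have h2 := h1.card_edgeFinset_le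
  simp only [Fintype.card_coe] at h2
  rw [← SimpleGraph.card_edgeFinset_turanGraph, ← turanEdges_eq_card] at h2
  refine le_trans ?_ h2
  refine (card_le_card fun c hc => ?_).trans
    (card_image_le (f := fun e : Sym2 S => col (e.map Subtype.val)) (s := G.edgeFinset))
  obtain ⟨a, b, ⟨ha, hb, hab⟩, rfl⟩ := hX c hc
  exact mem_image.2 ⟨s(⟨a, ha⟩, ⟨b, hb⟩), by simpa [G] using hab, rfl⟩

omit [DecidableEq V] in
lemma injOn_sup_edge (hH : Set.InjOn col H.edgeSet) {x y : V} (hf : FreshColor col H s(x, y)) :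
    Set.InjOn col (H ⊔ SimpleGraph.edge x y).edgeSet := by
  intro e he f hf' heq
  induction e with | _ a b => ?_
  induction f with | _ c d => ?_
  simp only [SimpleGraph.mem_edgeSet, SimpleGraph.sup_adj, SimpleGraph.edge_adj, ← Sym2.eq_iff]
    at he hf'
  rcases he with he | ⟨he, -⟩ <;> rcases hf' with hf' | ⟨hf', -⟩
  · exact eq_of_col_eq hH he hf' heq
  · exact absurd (hf' ▸ heq) (hf a b he)
  · exact absurd (he ▸ heq.symm) (hf c d hf')
  · rw [he, hf']

omit [DecidableEq V] in
lemma FreshColor.part_eq {p : V → Fin r} {S : Finset V} {x y : V}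
    (h : FreshColor col (multipartite p S) s(x, y)) (hx : x ∈ S) (hy : y ∈ S) : p x = p y := by
  by_contra hxy
  exact h x y ⟨hx, hy, hxy⟩ rfl

omit [DecidableEq V] in
lemma exists_ne_of_two_le_partSize {p : V → Fin r} {S : Finset V} {i : Fin r}
    (h : 2 ≤ partSize p S i) (c : V) : ∃ d ∈ S, p d = i ∧ d ≠ c := by
  obtain ⟨d, hd, hdc⟩ := exists_mem_ne (Nat.lt_of_succ_le h) c
  rw [mem_filter] at hd
  exact ⟨d, hd.1, hd.2, hdc⟩

section NoRainbowClique

variable {p : V → Fin r} {S : Finset V} (hno : ∀ K : Finset V, #K = r + 2 → ¬ RainbowSet col K)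
  (hT : Set.InjOn col (multipartite p S).edgeSet)
include hno hT

lemma exists_col_eq_of_freshColor (hpos : ∀ i, 0 < partSize p S i) {x₀ y₀ x y : V} (hx₀ : x₀ ∈ S)
    (hy₀ : y₀ ∈ S) (h₀ : x₀ ≠ y₀) (hf : FreshColor col (multipartite p S) s(x₀, y₀))
    (hx : x ∈ S) (hy : y ∈ S) (hxy : x ≠ y) (hpxy : p x = p y) (hpx : p x ≠ p x₀) :
    ∃ a b, ((multipartite p S).Adj a b ∨ s(a, b) = s(x₀, y₀)) ∧ col s(a, b) = col s(x, y) ∧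
      ((∀ i, 2 ≤ partSize p S i) → ∀ c ∈ s(a, b), c = x₀ ∨ c = y₀ ∨ c = x ∨ c = y) := by
  have hp₀ := hf.part_eq hx₀ hy₀
  have hN : ∀ c, c ∈ ({u ∈ S | p u ≠ p x₀ ∨ u = y₀} : Finset V) ↔ c ∈ S ∧ (p c ≠ p x₀ ∨ c = y₀) :=
    fun c => mem_filter
  obtain ⟨a, b, hab, hcol, hend⟩ := exists_adj_col_eq (injOn_sup_edge hT hf) hno (p := p)
    (N := {u ∈ S | p u ≠ p x₀ ∨ u = y₀}) (v := x₀) (x := x) (y := y)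
    (fun a ha b hb hab => Or.inl ⟨((hN a).1 ha).1, ((hN b).1 hb).1, hab⟩)
    (fun a ha => by
      obtain ⟨haS, ha | rfl⟩ := (hN a).1 ha
      · exact Or.inl ⟨hx₀, haS, ha.symm⟩
      · exact Or.inr (by simp [SimpleGraph.edge_adj, h₀]))
    (fun i => by
      by_cases hi : i = p x₀
      · exact ⟨y₀, (hN _).2 ⟨hy₀, Or.inr rfl⟩, hi ▸ hp₀.symm⟩
      · obtain ⟨u, hu⟩ := card_pos.1 (hpos i)
        obtain ⟨huS, hui⟩ := mem_filter.1 hu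
        exact ⟨u, (hN _).2 ⟨huS, Or.inl (hui ▸ hi)⟩, hui⟩)
    ((hN _).2 ⟨hx, Or.inl hpx⟩) ((hN _).2 ⟨hy, Or.inl (hpxy ▸ hpx)⟩) hxy hpxy
  refine ⟨a, b, ?_, hcol, fun h2 c hc => ?_⟩
  · simp only [SimpleGraph.sup_adj, SimpleGraph.edge_adj, ← Sym2.eq_iff] at hab
    exact hab.imp_right And.left
  · rcases hend c hc with h | h | h | ⟨hcN, h⟩
    · exact Or.inl h
    · exact Or.inr (Or.inr (Or.inl h))
    · exact Or.inr (Or.inr (Or.inr h))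
    · refine Or.inr (Or.inl ?_)
      by_contra hcy
      obtain ⟨hcS, hcp⟩ := (hN c).1 hcN
      replace hcp := hcp.resolve_right hcy
      obtain ⟨d, hdS, hdp, hdc⟩ := exists_ne_of_two_le_partSize (h2 (p c)) c
      exact hdc (h d ((hN d).2 ⟨hdS, Or.inl (hdp ▸ hcp)⟩) hdp)

lemma exists_common_vertex_of_freshColor (h2 : ∀ i, 2 ≤ partSize p S i) {x₀ y₀ x y : V}
    (hx₀ : x₀ ∈ S) (hy₀ : y₀ ∈ S) (h₀ : x₀ ≠ y₀)
    (hf : FreshColor col (multipartite p S) s(x₀, y₀))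
    (hx : x ∈ S) (hy : y ∈ S) (hxy : x ≠ y) (hpxy : p x = p y) (hpx : p x ≠ p x₀)
    (hne : col s(x, y) ≠ col s(x₀, y₀)) :
    ∃ z, (z = x ∨ z = y) ∧ ∃ w, (w = x₀ ∨ w = y₀) ∧ (multipartite p S).Adj z w ∧
      col s(x, y) = col s(z, w) := by
  have hp₀ := hf.part_eq hx₀ hy₀
  obtain ⟨a, b, hab, hcol, hend⟩ := exists_col_eq_of_freshColor hno hT
    (fun i => zero_lt_two.trans_le (h2 i)) hx₀ hy₀ h₀ hf hx hy hxy hpxy hpx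
  rcases hab with hab | hab
  · have hp := hab.2.2
    rcases hend h2 a (Sym2.mem_mk_left a b) with ha | ha | ha | ha <;>
      rcases hend h2 b (Sym2.mem_mk_right a b) with hb | hb | hb | hb <;>
      first
      | (refine absurd ?_ hp; simp only [ha, hb, hp₀, hpxy]; done)
      | (refine ⟨b, ?_, a, ?_, hab.symm, hcol.symm.trans (by rw [Sym2.eq_swap])⟩ <;>
          simp only [ha, hb, true_or, or_true]; done)
      | (refine ⟨a, ?_, b, ?_, hab, hcol.symm⟩ <;> simp only [ha, hb, true_or, or_true])
  · exact absurd (hcol.symm.trans (by rw [hab])) hne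

/-- At most one color on `S` is not on the edges of a rainbow balanced multipartite graph. -/
lemma col_eq_of_freshColor (hr : 3 ≤ r) (hp : EquipartitionOn p S) (hpos : ∀ i, 0 < partSize p S i)
    {x₁ y₁ x₂ y₂ : V} (hx₁ : x₁ ∈ S) (hy₁ : y₁ ∈ S) (h₁ : x₁ ≠ y₁)
    (hf₁ : FreshColor col (multipartite p S) s(x₁, y₁))
    (hx₂ : x₂ ∈ S) (hy₂ : y₂ ∈ S) (h₂ : x₂ ≠ y₂)
    (hf₂ : FreshColor col (multipartite p S) s(x₂, y₂)) : col s(x₁, y₁) = col s(x₂, y₂) := by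
  by_contra hne
  have hp₁ := hf₁.part_eq hx₁ hy₁
  have hp₂ := hf₂.part_eq hx₂ hy₂
  have hpp : p x₂ = p x₁ := by
    by_contra hpp
    obtain ⟨a, b, hab | hab, hcol, -⟩ := exists_col_eq_of_freshColor hno hT hpos hx₁ hy₁ h₁ hf₁
      hx₂ hy₂ h₂ hp₂ hpp
    · exact hf₂ a b hab hcol
    · exact hne (hab ▸ hcol)
  have h3 : 3 ≤ partSize p S (p x₁) := by
    have hz : ∃ z, z ∈ S ∧ p z = p x₁ ∧ z ≠ x₁ ∧ z ≠ y₁ := by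
      by_contra! hz
      have hx := hz x₂ hx₂ hpp
      have hy := hz y₂ hy₂ (hp₂ ▸ hpp)
      apply hne
      by_cases h : x₂ = x₁
      · have h' : y₂ = y₁ := hy fun h' => h₂ (h.trans h'.symm)
        rw [h, h']
      · rw [hx h] at h₂ ⊢
        have h' : y₂ = x₁ := by
          by_contra h'
          exact h₂ (hy h').symm
        rw [h', Sym2.eq_swap]
    obtain ⟨z, hz, hpz, hzx, hzy⟩ := hz
    have h3 : #({x₁, y₁, z} : Finset V) = 3 := by
      rw [card_insert_of_notMem, card_pair hzy.symm]
      simp [h₁, hzx.symm]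
    rw [← h3]
    refine card_le_card fun u hu => ?_
    simp only [mem_insert, mem_singleton] at hu
    rcases hu with rfl | rfl | rfl <;> simp [*]
  have h2 : ∀ i, 2 ≤ partSize p S i := fun i => by
    have := hp (p x₁) i
    omega
  have key : ∀ i ≠ p x₁, ∃ x ∈ S, ∃ y ∈ S, p x = i ∧ p y = i ∧ x ≠ y ∧ ∃ z, (z = x ∨ z = y) ∧
      ∃ w, (w = x₁ ∨ w = y₁) ∧ (w = x₂ ∨ w = y₂) ∧ (multipartite p S).Adj z w ∧
        col s(x, y) = col s(z, w) := by
    intro i hi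
    obtain ⟨x, hx⟩ := card_pos.1 (hpos i)
    obtain ⟨hxS, hxi⟩ := mem_filter.1 hx
    obtain ⟨y, hyS, hyi, hyx⟩ := exists_ne_of_two_le_partSize (h2 i) x
    have hpxy := hxi.trans hyi.symm
    have hne₁ : col s(x, y) ≠ col s(x₁, y₁) := fun h => by
      obtain ⟨a, b, hab | hab, hcol, -⟩ := exists_col_eq_of_freshColor hno hT hpos hx₂ hy₂ h₂ hf₂
        hxS hyS hyx.symm hpxy (hpp ▸ hxi ▸ hi)
      · exact hf₁ a b hab (hcol.trans h)
      · exact hne (h.symm.trans (hcol.symm.trans (by rw [hab])))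
    have hne₂ : col s(x, y) ≠ col s(x₂, y₂) := fun h => by
      obtain ⟨a, b, hab | hab, hcol, -⟩ := exists_col_eq_of_freshColor hno hT hpos hx₁ hy₁ h₁ hf₁
        hxS hyS hyx.symm hpxy (hxi ▸ hi)
      · exact hf₂ a b hab (hcol.trans h)
      · exact hne (Eq.trans (by rw [hab]) (hcol.trans h))
    obtain ⟨z, hz, w, hw, hzw, hc⟩ := exists_common_vertex_of_freshColor hno hT h2 hx₁ hy₁ h₁ hf₁
      hxS hyS hyx.symm hpxy (hxi ▸ hi) hne₁
    obtain ⟨z', hz', w', hw', hzw', hc'⟩ := exists_common_vertex_of_freshColor hno hT h2 hx₂ hy₂ h₂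
      hf₂ hxS hyS hyx.symm hpxy (hpp ▸ hxi ▸ hi) hne₂
    have heq := eq_of_col_eq hT hzw hzw' (hc.symm.trans hc')
    have hww : w = w' := by
      rcases Sym2.eq_iff.1 heq with ⟨-, h⟩ | ⟨h, h'⟩
      · exact h
      · exfalso
        apply hi
        rw [← hpp, ← hxi]
        have e1 : p z = p x := by rcases hz with rfl | rfl <;> simp [hpxy]
        have e2 : p w' = p x₂ := by rcases hw' with rfl | rfl <;> simp [hp₂]
        rw [← e1, h, e2]
    exact ⟨x, hxS, y, hyS, hxi, hyi, hyx.symm, z, hz, w, hw, hww ▸ hw', hzw, hc⟩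
  obtain ⟨i, hi⟩ : ∃ i, i ∉ ({p x₁} : Finset (Fin r)) :=
    exists_mem_notMem_of_card_lt_card (s := {p x₁}) (t := univ) (by simp; omega) |>.imp
      fun _ h => h.2
  obtain ⟨l, hl⟩ : ∃ l, l ∉ ({p x₁, i} : Finset (Fin r)) :=
    exists_mem_notMem_of_card_lt_card (s := {p x₁, i}) (t := univ)
      (card_le_two.trans_lt (by simp; omega)) |>.imp fun _ h => h.2
  simp only [mem_insert, mem_singleton, not_or] at hi hl
  obtain ⟨x, hx, y, hy, hxi, hyi, hxy, z, hz, w, hw₁, hw₂, hzw, hc⟩ := key i hi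
  obtain ⟨x', hx', y', hy', hxi', hyi', hxy', z', hz', w', hw₁', hw₂', hzw', hc'⟩ := key l hl.1
  have hww : w' = w := by
    by_contra hww
    apply hne
    congr 1
    rw [Sym2.eq_iff]
    grind
  subst hww
  obtain ⟨v, hvS, hvp, hvw⟩ := exists_ne_of_two_le_partSize (h2 (p x₁)) w'
  have hwp : p w' = p x₁ := by rcases hw₁ with rfl | rfl <;> simp [hp₁]
  have hN : ∀ c, c ∈ ({u ∈ S | p u ≠ p x₁} : Finset V) ↔ c ∈ S ∧ p c ≠ p x₁ := fun c => mem_filter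
  obtain ⟨K, hK, hK'⟩ := exists_rainbowSet_of_common_vertex hT (p := p)
    (N := {u ∈ S | p u ≠ p x₁}) (v := v) (w := w') (j := p x₁) (x := x) (y := y) (x' := x')
    (y' := y') (fun a ha b hb hab => ⟨((hN a).1 ha).1, ((hN b).1 hb).1, hab⟩)
    (fun a ha => ⟨hvS, ((hN a).1 ha).1, hvp ▸ ((hN a).1 ha).2.symm⟩)
    (fun j hj => by
      obtain ⟨u, hu⟩ := card_pos.1 (hpos j)
      obtain ⟨huS, huj⟩ := mem_filter.1 hu
      exact ⟨u, (hN u).2 ⟨huS, huj ▸ hj⟩, huj⟩)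
    hvw.symm (fun _ => hwp) ((hN _).2 ⟨hx, hxi ▸ hi⟩) ((hN _).2 ⟨hy, hyi ▸ hi⟩)
    ((hN _).2 ⟨hx', hxi' ▸ hl.1⟩) ((hN _).2 ⟨hy', hyi' ▸ hl.1⟩) hxy hxy' (hxi.trans hyi.symm)
    (hxi'.trans hyi'.symm) (by rw [hxi, hxi']; exact Ne.symm hl.2) (hxi ▸ hi) (hxi' ▸ hl.1)
    ⟨z, hz, hzw, hc⟩ ⟨z', hz', hzw', hc'⟩
  exact hno K hK hK'

end NoRainbowClique

/-- The graph obtained from `G` by joining `v` to the vertices in `N`. -/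
def joinVertex (G : SimpleGraph V) (v : V) (N : Finset V) : SimpleGraph V :=
  G ⊔ SimpleGraph.fromRel fun a b => a = v ∧ b ∈ N

section JoinVertex

variable {p : V → Fin r} {S N : Finset V} {v : V} (hvS : v ∉ S) (hNS : N ⊆ S)
include hvS hNS

omit [DecidableEq V] in
lemma joinVertex_adj_of_mem {G : SimpleGraph V} {u : V} (hu : u ∈ N) :
    (joinVertex G v N).Adj v u := by
  have : v ≠ u := fun h => hvS (h ▸ hNS hu)
  simp [joinVertex, this, hu]

omit [DecidableEq V] hvS hNS in
lemma exists_of_joinVertex_adj {a b : V} (h : (joinVertex (multipartite p S) v N).Adj a b) :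
    (multipartite p S).Adj a b ∨ ∃ u ∈ N, s(a, b) = s(v, u) := by
  simp only [joinVertex, SimpleGraph.sup_adj, SimpleGraph.fromRel_adj] at h
  rcases h with h | ⟨-, ⟨rfl, h⟩ | ⟨rfl, h⟩⟩
  · exact Or.inl h
  · exact Or.inr ⟨b, h, rfl⟩
  · exact Or.inr ⟨a, h, Sym2.eq_swap⟩

variable (hnew : ∀ u ∈ N, col s(v, u) ∉ colorsOn col S)
include hnew

omit [DecidableEq V] hvS hNS in
lemma multipartite_adj_of_joinVertex_adj {a b x y : V}
    (h : (joinVertex (multipartite p S) v N).Adj a b) (hx : x ∈ S) (hy : y ∈ S) (hxy : x ≠ y)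
    (hcol : col s(a, b) = col s(x, y)) : (multipartite p S).Adj a b := by
  refine (exists_of_joinVertex_adj h).resolve_right ?_
  rintro ⟨u, hu, heq⟩
  exact hnew u hu (mem_colorsOn.2 ⟨x, hx, y, hy, hxy, by rw [← hcol, heq]⟩)

omit [DecidableEq V] hvS hNS in
lemma freshColor_joinVertex {x y : V} (hx : x ∈ S) (hy : y ∈ S) (hxy : x ≠ y)
    (hf : FreshColor col (multipartite p S) s(x, y)) :
    FreshColor col (joinVertex (multipartite p S) v N) s(x, y) := fun a b hab hcol =>
  hf a b (multipartite_adj_of_joinVertex_adj hnew hab hx hy hxy hcol) hcol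

variable (hT : Set.InjOn col (multipartite p S).edgeSet)
  (hinj : ∀ a ∈ N, ∀ b ∈ N, col s(v, a) = col s(v, b) → a = b)
include hT hinj

omit [DecidableEq V] hvS hNS in
lemma injOn_joinVertex : Set.InjOn col (joinVertex (multipartite p S) v N).edgeSet := by
  intro e he f hf heq
  induction e with | _ a b => ?_
  induction f with | _ c d => ?_
  have key : ∀ a b u, (multipartite p S).Adj a b → u ∈ N → col s(a, b) ≠ col s(v, u) :=
    fun a b u h hu heq => hnew u hu (mem_colorsOn.2 ⟨a, h.1, b, h.2.1, h.ne, heq⟩)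
  rcases exists_of_joinVertex_adj he with he | ⟨u, hu, he⟩ <;>
    rcases exists_of_joinVertex_adj hf with hf | ⟨w, hw, hf⟩
  · exact eq_of_col_eq hT he hf heq
  · exact absurd (hf ▸ heq) (key a b w he hw)
  · exact absurd (he ▸ heq.symm) (key c d u hf hu)
  · rw [he, hf] at heq ⊢
    rw [hinj u hu w hw heq]

lemma exists_equipartitionOn_of_part (hp : EquipartitionOn p S)
    (hN : #(S \ N) = #S / r) {i : Fin r} (hi : ∀ u ∈ N, p u ≠ i) :
    ∃ p' : V → Fin r, EquipartitionOn p' (insert v S) ∧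
      Set.InjOn col (multipartite p' (insert v S)).edgeSet := by
  have hsub : {u ∈ S | p u = i} ⊆ S \ N := fun u hu => by
    rw [mem_filter] at hu
    exact mem_sdiff.2 ⟨hu.1, fun h => hi u h hu.2⟩
  have heq : {u ∈ S | p u = i} = S \ N := eq_of_subset_of_card_le hsub (hN ▸ hp.div_le i)
  have hmem : ∀ u ∈ S, i ≠ p u → u ∈ N := fun u hu hui => by
    by_contra huN
    have h := mem_sdiff.2 ⟨hu, huN⟩
    rw [← heq, mem_filter] at h
    exact hui h.2.symm
  have hsize : partSize p S i = #S / r := by rw [partSize, heq, hN]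
  refine ⟨_, hp.update_insert hvS hsize, Set.InjOn.mono ?_
    (injOn_joinVertex hnew hT hinj)⟩
  refine SimpleGraph.edgeSet_mono fun a b hab => ?_
  obtain ⟨ha, hb, hab⟩ := hab
  rcases mem_insert.1 ha with rfl | haS
  · rcases mem_insert.1 hb with rfl | hbS
    · exact absurd rfl hab
    · rw [Function.update_self, Function.update_of_ne (ne_of_mem_of_not_mem hbS hvS)] at hab
      exact joinVertex_adj_of_mem hvS hNS (hmem b hbS hab)
  · rcases mem_insert.1 hb with rfl | hbS
    · rw [Function.update_self, Function.update_of_ne (ne_of_mem_of_not_mem haS hvS)] at hab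
      exact (joinVertex_adj_of_mem hvS hNS (hmem a haS hab.symm)).symm
    · rw [Function.update_of_ne (ne_of_mem_of_not_mem hbS hvS),
        Function.update_of_ne (ne_of_mem_of_not_mem haS hvS)] at hab
      exact Or.inl ⟨haS, hbS, hab⟩

/-- If `v` misses the single vertex `m` and `mw` has a fresh color, then the parts `{m, w}` and
`{a}` can be replaced by `{m, v}` and `{w, a}`. -/
lemma exists_equipartitionOn_of_sdiff_eq_singleton (hp : EquipartitionOn p S) (hr : 0 < r)
    (hS : #S / r = 1) {m w : V} (hN : S \ N = {m}) (hm : m ∈ S) (hw : w ∈ S) (hmw : m ≠ w)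
    (hf : FreshColor col (multipartite p S) s(m, w)) :
    ∃ p' : V → Fin r, EquipartitionOn p' (insert v S) ∧
      Set.InjOn col (multipartite p' (insert v S)).edgeSet := by
  have hpmw := hf.part_eq hm hw
  obtain ⟨i, hi⟩ := hp.exists_eq_div hr
  have hmem : ∀ u ∈ S, u ≠ m → u ∈ N := fun u hu hum => by
    by_contra huN
    have h := mem_sdiff.2 ⟨hu, huN⟩
    rw [hN, mem_singleton] at h
    exact hum h
  have hpart : ∀ u ∈ S, p u = p m → u = m ∨ u = w := by
    have h1 : ({m, w} : Finset V) = {u ∈ S | p u = p m} := by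
      refine eq_of_subset_of_card_le (fun u hu => ?_) ?_
      · simp only [mem_insert, mem_singleton] at hu
        rcases hu with rfl | rfl <;> simp [*]
      · rw [card_pair hmw]
        have := hp.le_div (p m)
        rw [hS] at this
        exact this
    intro u hu hup
    have h2 : u ∈ ({m, w} : Finset V) := h1 ▸ mem_filter.2 ⟨hu, hup⟩
    simpa using h2
  have hvw : w ≠ v := ne_of_mem_of_not_mem hw hvS
  refine ⟨_, (hp.update_insert hvS hi).comp_perm (Equiv.swap v w) fun u => ?_, Set.InjOn.mono ?_
    (injOn_sup_edge (injOn_joinVertex hnew hT hinj)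
      (freshColor_joinVertex hnew hm hw hmw hf))⟩
  · by_cases h1 : u = v
    · simp [h1, hw]
    · by_cases h2 : u = w
      · simp [h2, hw]
      · rw [Equiv.swap_apply_of_ne_of_ne h1 h2]
  set p' : V → Fin r := Function.update p v i ∘ Equiv.swap v w with hp'
  have h1 : p' v = p m := by simp [hp', hvw, hpmw]
  have h3 : ∀ u ∈ S, u ≠ w → p' u = p u := fun u hu huw => by
    have huv := ne_of_mem_of_not_mem hu hvS
    simp [hp', Equiv.swap_apply_of_ne_of_ne huv huw, huv]
  have hv : ∀ b ∈ S, p' v ≠ p' b → (joinVertex (multipartite p S) v N).Adj v b := by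
    intro b hb hab
    refine joinVertex_adj_of_mem hvS hNS (hmem b hb ?_)
    rintro rfl
    exact hab (by rw [h1, h3 b hm hmw])
  have hw' : ∀ b ∈ S, b ≠ w → (joinVertex (multipartite p S) v N ⊔ SimpleGraph.edge m w).Adj w b :=
    by
    intro b hb hbw
    by_cases hbm : b = m
    · right
      simp [SimpleGraph.edge_adj, hbm, hmw.symm]
    · refine Or.inl (Or.inl ⟨hw, hb, fun h => ?_⟩)
      rcases hpart b hb (h.symm.trans hpmw.symm) with h | h
      · exact hbm h
      · exact hbw h
  refine SimpleGraph.edgeSet_mono fun a b hab => ?_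
  have hne := hab.ne
  obtain ⟨ha, hb, hab⟩ := hab
  rcases mem_insert.1 ha with rfl | haS
  · exact Or.inl (hv b (mem_of_mem_insert_of_ne hb hne.symm) hab)
  rcases mem_insert.1 hb with rfl | hbS
  · exact Or.inl (hv a haS hab.symm).symm
  by_cases haw : a = w
  · subst haw
    exact hw' b hbS hne.symm
  by_cases hbw : b = w
  · subst hbw
    exact (hw' a haS hne).symm
  rw [h3 a haS haw, h3 b hbS hbw] at hab
  exact Or.inl (Or.inl ⟨haS, hbS, hab⟩)

section NoRainbowClique

variable (hno : ∀ K : Finset V, #K = r + 2 → ¬ RainbowSet col K) (hN : ∀ i, ∃ a ∈ N, p a = i)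
include hno hN

lemma exists_joinVertex_adj_col_eq {x y : V} (hx : x ∈ N) (hy : y ∈ N) (hxy : x ≠ y)
    (hpxy : p x = p y) :
    ∃ a b, (multipartite p S).Adj a b ∧ col s(a, b) = col s(x, y) ∧
      ∀ c ∈ s(a, b), c = x ∨ c = y ∨ c ∈ N ∧ ∀ d ∈ N, p d = p c → d = c := by
  obtain ⟨a, b, hab, hcol, hend⟩ := exists_adj_col_eq (injOn_joinVertex hnew hT hinj) hno (p := p)
    (N := N) (v := v) (fun a ha b hb hab => Or.inl ⟨hNS ha, hNS hb, hab⟩)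
    (fun a ha => joinVertex_adj_of_mem hvS hNS ha) hN hx hy hxy hpxy
  have hab' := multipartite_adj_of_joinVertex_adj hnew hab (hNS hx) (hNS hy) hxy hcol
  refine ⟨a, b, hab', hcol, fun c hc => (hend c hc).resolve_left ?_⟩
  rintro rfl
  rcases Sym2.mem_iff.1 hc with rfl | rfl
  · exact hvS hab'.1
  · exact hvS hab'.2.1

lemma notMem_or_notMem_of_freshColor {x y : V} (hx : x ∈ S) (hy : y ∈ S) (hxy : x ≠ y)
    (hf : FreshColor col (multipartite p S) s(x, y)) : x ∉ N ∨ y ∉ N := by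
  by_contra! h
  obtain ⟨a, b, hab, hcol, -⟩ := exists_joinVertex_adj_col_eq hvS hNS hnew hT hinj hno hN h.1 h.2
    hxy (hf.part_eq hx hy)
  exact hf a b hab hcol

lemma not_freshColor_of_two_le (hp : EquipartitionOn p S) (hr : 4 ≤ r) (hS : 2 ≤ #S / r)
    (hSN : #(S \ N) = #S / r) {x y : V} (hx : x ∈ S) (hy : y ∈ S) (hxy : x ≠ y) :
    ¬ FreshColor col (multipartite p S) s(x, y) := by
  classical
  intro hf
  wlog hxN : x ∉ N generalizing x y
  · have hyN := (notMem_or_notMem_of_freshColor hvS hNS hnew hT hinj hno hN hx hy hxy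
      hf).resolve_left hxN
    exact this hy hx hxy.symm (by rwa [Sym2.eq_swap]) hyN
  have hpxy := hf.part_eq hx hy
  set U : Finset V := {a ∈ N | ∀ d ∈ N, p d = p a → d = a} with hU
  have hmemU : ∀ a, a ∈ U ↔ a ∈ N ∧ ∀ d ∈ N, p d = p a → d = a := fun a => mem_filter
  have hcard : ∀ M : Finset V, (∀ m ∈ S \ N, ∀ u ∈ U, p m = p u → m ∈ M) →
      #U * (#S / r - 1) ≤ #M := by
    intro M hM
    calc #U * (#S / r - 1) = ∑ u ∈ U, (#S / r - 1) := by simp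
      _ ≤ ∑ u ∈ U, #{m ∈ S \ N | p m = p u} := by
        refine sum_le_sum fun u hu => Nat.sub_le_iff_le_add.2 ?_
        refine (hp.div_le (p u)).trans ((card_le_card fun m hm => ?_).trans (card_insert_le u _))
        obtain ⟨hmS, hmp⟩ := mem_filter.1 hm
        by_cases hmN : m ∈ N
        · exact mem_insert.2 (Or.inl (((hmemU u).1 hu).2 m hmN hmp))
        · exact mem_insert_of_mem (mem_filter.2 ⟨mem_sdiff.2 ⟨hmS, hmN⟩, hmp⟩)
      _ = #(U.biUnion fun u => {m ∈ S \ N | p m = p u}) := by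
        refine (card_biUnion fun u hu w hw huw => disjoint_left.2 fun m hm hm' => huw ?_).symm
        refine ((hmemU w).1 hw).2 u ((hmemU u).1 hu).1 ?_
        rw [← (mem_filter.1 hm).2, (mem_filter.1 hm').2]
      _ ≤ #M := by
        refine card_le_card fun m hm => ?_
        obtain ⟨u, hu, hm⟩ := mem_biUnion.1 hm
        obtain ⟨hmS, hmp⟩ := mem_filter.1 hm
        exact hM m hmS u hu hmp
  have h2 : ∀ i, 2 ≤ partSize p S i := fun i => hS.trans (hp.div_le i)
  have hU2 : #U ≤ 2 := by
    have h := hSN ▸ hcard (S \ N) fun m hm _ _ _ => hm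
    obtain ⟨q, hq⟩ := Nat.exists_eq_add_of_le hS
    rw [hq] at h
    have h' : 2 + q - 1 = q + 1 := by omega
    rw [h'] at h
    nlinarith
  obtain ⟨w, hw⟩ : ∃ w, ∀ a ∈ N, ∀ b ∈ N, a ≠ b → p a = p b →
      ∃ z, (z = a ∨ z = b) ∧ (multipartite p S).Adj z w ∧ col s(a, b) = col s(z, w) := by
    by_cases hxU : ∃ u ∈ U, p x = p u
    · obtain ⟨u, hu, hxu⟩ := hxU
      refine ⟨u, fun a ha b hb hab hpab => ?_⟩
      have hau : p a ≠ p u := fun h => hab ((((hmemU u).1 hu).2 a ha h).trans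
        (((hmemU u).1 hu).2 b hb (hpab ▸ h)).symm)
      obtain ⟨c, d, hcd, hcol, hend⟩ := exists_joinVertex_adj_col_eq hvS hNS hnew hT hinj hno hN
        ha hb hab hpab
      obtain ⟨z, hz, t, ht, hzt, hcol'⟩ := exists_common_vertex_of_freshColor hno hT h2 hx hy hxy hf
        (hNS ha) (hNS hb) hab hpab (hxu ▸ hau) (hcol ▸ hf c d hcd)
      have heq := eq_of_col_eq hT hcd hzt (hcol.trans hcol')
      have hpt : p t = p u := by rcases ht with rfl | rfl <;> simp [← hxu, hpxy]
      have htu : t = u := by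
        rcases hend t (heq ▸ Sym2.mem_mk_right z t) with rfl | rfl | ⟨-, h⟩
        · exact absurd hpt hau
        · exact absurd (hpab.trans hpt) hau
        · exact (h u ((hmemU u).1 hu).1 hpt.symm).symm
      exact ⟨z, hz, htu ▸ hzt, htu ▸ hcol'⟩
    · push Not at hxU
      have hU1 : #U ≤ 1 := by
        have h := hcard ((S \ N).erase x) fun m hm u hu hmu => mem_erase.2
          ⟨fun h => hxU u hu (h ▸ hmu), hm⟩
        rw [card_erase_of_mem (mem_sdiff.2 ⟨hx, hxN⟩), hSN] at h
        exact Nat.le_of_mul_le_mul_right (by simpa using h) (by omega)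
      obtain ⟨w, hw⟩ : ∃ w, ∀ u ∈ U, u = w := by
        rcases U.eq_empty_or_nonempty with h | ⟨w, hw⟩
        · exact ⟨x, by simp [h]⟩
        · exact ⟨w, fun u hu => card_le_one.1 hU1 u hu w hw⟩
      refine ⟨w, fun a ha b hb hab hpab => ?_⟩
      obtain ⟨c, d, hcd, hcol, hend⟩ := exists_joinVertex_adj_col_eq hvS hNS hnew hT hinj hno hN
        ha hb hab hpab
      have hp' := hcd.2.2
      have hend' : ∀ e ∈ s(c, d), e = a ∨ e = b ∨ e = w := fun e he =>
        (hend e he).imp_right fun h => h.imp_right fun h => hw e ((hmemU e).2 h)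
      rcases hend' c (Sym2.mem_mk_left c d) with hc | hc | hc <;>
        rcases hend' d (Sym2.mem_mk_right c d) with hd | hd | hd <;>
        first
        | (refine absurd ?_ hp'; simp only [hc, hd, hpab]; done)
        | (subst hd; exact ⟨c, by simp [hc], hcd, hcol.symm⟩)
        | (subst hc; exact ⟨d, by simp [hd], hcd.symm, hcol.symm.trans (by rw [Sym2.eq_swap])⟩)
  have hpair : ∀ i ∉ U.image p, ∃ a ∈ N, ∃ b ∈ N, a ≠ b ∧ p a = i ∧ p b = i := by
    intro i hi
    obtain ⟨a, ha, hai⟩ := hN i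
    by_contra! h
    refine hi (mem_image.2 ⟨a, (hmemU a).2 ⟨ha, fun d hd hda => ?_⟩, hai⟩)
    by_contra hne
    exact h a ha d hd (Ne.symm hne) hai (hda.trans hai)
  obtain ⟨i, hi⟩ : ∃ i, i ∉ U.image p :=
    exists_mem_notMem_of_card_lt_card (s := U.image p) (t := univ)
      (card_image_le.trans_lt (by simp; omega)) |>.imp fun _ h => h.2
  obtain ⟨l, hl⟩ : ∃ l, l ∉ insert i (U.image p) :=
    exists_mem_notMem_of_card_lt_card (s := insert i (U.image p)) (t := univ)
      ((card_insert_le _ _).trans_lt (by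
        have := card_image_le (s := U) (f := p)
        simp
        omega)) |>.imp fun _ h => h.2
  simp only [mem_insert, not_or] at hl
  obtain ⟨a, ha, b, hb, hab, hai, hbi⟩ := hpair i hi
  obtain ⟨c, hc, d, hd, hcd, hcl, hdl⟩ := hpair l hl.2
  have hwp : ∀ a ∈ N, ∀ b ∈ N, a ≠ b → p a = p b → p a ≠ p w ∧ w ∈ S := by
    intro a ha b hb hab hpab
    obtain ⟨z, rfl | rfl, hz, -⟩ := hw a ha b hb hab hpab
    · exact ⟨hz.2.2, hz.2.1⟩
    · exact ⟨hpab ▸ hz.2.2, hz.2.1⟩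
  have hw' : ∀ a ∈ N, ∀ b ∈ N, a ≠ b → p a = p b → ∃ z, (z = a ∨ z = b) ∧
      (joinVertex (multipartite p S) v N).Adj z w ∧ col s(a, b) = col s(z, w) :=
    fun a ha b hb hab hpab => (hw a ha b hb hab hpab).imp fun z h => ⟨h.1, Or.inl h.2.1, h.2.2⟩
  have hpab := hai.trans hbi.symm
  have hpcd := hcl.trans hdl.symm
  obtain ⟨K, hK, hK'⟩ := exists_rainbowSet_of_common_vertex (injOn_joinVertex hnew hT hinj) (p := p)
    (N := N) (v := v) (w := w) (j := p w) (fun a ha b hb hab => Or.inl ⟨hNS ha, hNS hb, hab⟩)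
    (fun a ha => joinVertex_adj_of_mem hvS hNS ha) (fun i _ => hN i)
    (ne_of_mem_of_not_mem (hwp a ha b hb hab hpab).2 hvS) (fun _ => rfl) ha hb hc hd hab hcd
    hpab hpcd (by rw [hai, hcl]; exact Ne.symm hl.1) (hwp a ha b hb hab hpab).1
    (hwp c hc d hd hcd hpcd).1 (hw' a ha b hb hab hpab) (hw' c hc d hd hcd hpcd)
  exact hno K hK hK'

end NoRainbowClique

end JoinVertex

lemma exists_equipartitionOn_insert (hno : ∀ K : Finset V, #K = r + 2 → ¬ RainbowSet col K)
    (hr : 4 ≤ r) {p : V → Fin r} {S : Finset V} {v : V} (hvS : v ∉ S) (hS : r + 1 ≤ #S)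
    (hp : EquipartitionOn p S) (hT : Set.InjOn col (multipartite p S).edgeSet)
    (hc : turanEdges #S r + 1 ≤ #(colorsOn col S))
    (hc' : turanEdges (#S + 1) r + 1 ≤ #(colorsOn col (insert v S)))
    (hv : #(colorsOn col (insert v S) \ colorsOn col S) ≤ #S - #S / r) :
    ∃ p' : V → Fin r, EquipartitionOn p' (insert v S) ∧
      Set.InjOn col (multipartite p' (insert v S)).edgeSet := by
  classical
  have hr0 : 0 < r := by omega
  have hS1 : 1 ≤ #S / r := (Nat.one_le_div_iff hr0).2 (by omega)
  have hpos : ∀ i, 0 < partSize p S i := fun i => hS1.trans (hp.div_le i)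
  set X := {c ∈ colorsOn col S | ∀ a b, (multipartite p S).Adj a b → col s(a, b) ≠ c} with hX
  have hXc : #(colorsOn col S \ X) ≤ turanEdges #S r := by
    refine card_colors_multipartite_le (col := col) p S _ fun c hc => ?_
    rw [hX, mem_sdiff, mem_filter, not_and] at hc
    simpa using hc.2 hc.1
  have hX1 : #X ≤ 1 := by
    refine card_le_one.2 fun c hc d hd => ?_
    obtain ⟨hc, hcf⟩ := mem_filter.1 hc
    obtain ⟨hd, hdf⟩ := mem_filter.1 hd
    obtain ⟨a, ha, b, hb, hab, rfl⟩ := mem_colorsOn.1 hc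
    obtain ⟨a', ha', b', hb', hab', rfl⟩ := mem_colorsOn.1 hd
    exact col_eq_of_freshColor hno hT (by omega) hp hpos ha hb hab hcf ha' hb' hab' hdf
  have hsub : X ⊆ colorsOn col S := filter_subset _ _
  have hcX := card_sdiff_add_card_eq_card hsub
  obtain ⟨c, hcX⟩ : X.Nonempty := card_pos.1 (by omega)
  obtain ⟨hc, hf⟩ := mem_filter.1 hcX
  obtain ⟨x, hx, y, hy, hxy, rfl⟩ := mem_colorsOn.1 hc
  set C := colorsOn col (insert v S) \ colorsOn col S with hC
  have hCcard : #C = #S - #S / r := by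
    have h1 : #C + #(colorsOn col S) = #(colorsOn col (insert v S)) :=
      card_sdiff_add_card_eq_card (colorsOn_mono (subset_insert v S))
    have h2 := turanEdges_succ #S hr0
    omega
  have hCv : ∀ c ∈ C, ∃ u ∈ S, col s(v, u) = c := by
    intro c hc
    obtain ⟨hc, hcS⟩ := mem_sdiff.1 hc
    obtain ⟨a, ha, b, hb, hab, rfl⟩ := mem_colorsOn.1 hc
    rcases mem_insert.1 ha with rfl | ha'
    · exact ⟨b, mem_of_mem_insert_of_ne hb hab.symm, rfl⟩
    rcases mem_insert.1 hb with rfl | hb'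
    · exact ⟨a, ha', by rw [Sym2.eq_swap]⟩
    · exact absurd (mem_colorsOn.2 ⟨a, ha', b, hb', hab, rfl⟩) hcS
  have : Nonempty V := ⟨v⟩
  choose! f hfS hfc using hCv
  set N := C.image f with hN
  have hNS : N ⊆ S := image_subset_iff.2 hfS
  have hnew : ∀ u ∈ N, col s(v, u) ∉ colorsOn col S := by
    intro u hu
    obtain ⟨c, hc, rfl⟩ := mem_image.1 hu
    rw [hfc c hc]
    exact (mem_sdiff.1 hc).2
  have hinj : ∀ a ∈ N, ∀ b ∈ N, col s(v, a) = col s(v, b) → a = b := by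
    intro a ha b hb hab
    obtain ⟨c, hc, rfl⟩ := mem_image.1 ha
    obtain ⟨d, hd, rfl⟩ := mem_image.1 hb
    rw [hfc c hc, hfc d hd] at hab
    rw [hab]
  have hNcard : #N = #C := card_image_of_injOn fun c hc d hd hcd => by
    rw [← hfc c hc, hcd, hfc d hd]
  have hSN : #(S \ N) = #S / r := by
    have h1 := card_sdiff_add_card_eq_card hNS
    have h2 := Nat.div_le_self #S r
    omega
  by_cases hpart : ∀ i, ∃ a ∈ N, p a = i
  · by_cases hS2 : 2 ≤ #S / r
    · exact absurd hf (not_freshColor_of_two_le hvS hNS hnew hT hinj hno hpart hp hr hS2 hSN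
        hx hy hxy)
    · have hS1' : #S / r = 1 := by omega
      obtain ⟨m, hm⟩ := card_eq_one.1 (hSN.trans hS1')
      have hmem : ∀ u ∈ S, u ∉ N → u = m := fun u hu huN => by
        rw [← mem_singleton, ← hm]
        exact mem_sdiff.2 ⟨hu, huN⟩
      rcases notMem_or_notMem_of_freshColor hvS hNS hnew hT hinj hno hpart hx hy hxy hf with h | h
      · obtain rfl := hmem x hx h
        exact exists_equipartitionOn_of_sdiff_eq_singleton hvS hNS hnew hT hinj hp hr0 hS1' hm hx hy
          hxy hf
      · obtain rfl := hmem y hy h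
        exact exists_equipartitionOn_of_sdiff_eq_singleton hvS hNS hnew hT hinj hp hr0 hS1' hm hy hx
          hxy.symm (by rwa [Sym2.eq_swap])
  · push Not at hpart
    obtain ⟨i, hi⟩ := hpart
    exact exists_equipartitionOn_of_part hvS hNS hnew hT hinj hp hSN hi

lemma turanEdges_succ_self_add_one {r : ℕ} (hr : 0 < r) :
    turanEdges (r + 1) r + 1 = (r + 1).choose 2 := by
  obtain ⟨r, rfl⟩ := Nat.exists_eq_add_one.2 hr
  have h := two_mul_turanEdges r 1 1 (by omega)
  rw [one_mul] at h
  push_cast at h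
  rw [Nat.choose_two_right]
  have h3 := Nat.div_mul_cancel (Nat.even_mul_pred_self (r + 1 + 1)).two_dvd
  zify at h3
  simp only [Nat.add_sub_cancel] at h3
  push_cast at h3
  zify
  push_cast
  nlinarith

lemma rainbowSet_of_card_colorsOn {S : Finset V} (h : (#S).choose 2 ≤ #(colorsOn col S)) :
    RainbowSet col S := by
  have hinj : Set.InjOn col (S.offDiag.image Sym2.mk.uncurry : Finset (Sym2 V)) := by
    refine injOn_of_card_image_eq (le_antisymm card_image_le ?_)
    rw [Sym2.card_image_offDiag, image_image]
    exact h
  intro a ha b hb c hc d hd hab hcd heq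
  refine hinj ?_ ?_ heq
  · exact mem_coe.2 (mem_image.2 ⟨(a, b), mem_offDiag.2 ⟨ha, hb, hab⟩, rfl⟩)
  · exact mem_coe.2 (mem_image.2 ⟨(c, d), mem_offDiag.2 ⟨hc, hd, hcd⟩, rfl⟩)

omit [DecidableEq V] in
/-- Colors can be merged so that a prescribed number of them remains. -/
lemma exists_card_colorsOn_comp_eq {S : Finset V} {t : ℕ} (ht : t + 1 ≤ #(colorsOn col S)) :
    ∃ f : ℕ → ℕ, #(colorsOn (f ∘ col) S) = t + 1 := by
  classical
  obtain ⟨D, hD, hDt⟩ := exists_subset_card_eq ((Nat.le_succ t).trans ht)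
  obtain ⟨c₀, hc₀, hc₀D⟩ := exists_mem_notMem_of_card_lt_card (hDt.trans_lt ht)
  refine ⟨fun c => if c ∈ D then c else c₀, ?_⟩
  rw [← hDt, ← card_insert_of_notMem hc₀D]
  congr 1
  ext c
  rw [mem_insert, mem_colorsOn]
  constructor
  · rintro ⟨a, -, b, -, -, rfl⟩
    by_cases h : col s(a, b) ∈ D
    · simp [h]
    · simp [h]
  · rintro (rfl | hc)
    · obtain ⟨a, ha, b, hb, hab, rfl⟩ := mem_colorsOn.1 hc₀
      exact ⟨a, ha, b, hb, hab, by simp⟩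
    · obtain ⟨a, ha, b, hb, hab, rfl⟩ := mem_colorsOn.1 (hD hc)
      exact ⟨a, ha, b, hb, hab, by simp [hc]⟩

theorem exists_equipartitionOn (hr : 4 ≤ r) {n : ℕ} (hn : r + 1 ≤ n) {S : Finset V} (hS : #S = n)
    (hno : ∀ K : Finset V, #K = r + 2 → ¬ RainbowSet col K)
    (hc : turanEdges n r + 1 ≤ #(colorsOn col S)) :
    ∃ p : V → Fin r, EquipartitionOn p S ∧ Set.InjOn col (multipartite p S).edgeSet := by
  have hr0 : 0 < r := by omega
  induction n, hn using Nat.le_induction generalizing col S with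
  | base =>
    rw [turanEdges_succ_self_add_one hr0, ← hS] at hc
    have hR := rainbowSet_of_card_colorsOn hc
    obtain ⟨p, hp⟩ := exists_balanced hr0 S
    refine ⟨p, hp, fun e he f hf heq => ?_⟩
    induction e with | _ a b => ?_
    induction f with | _ c d => ?_
    exact hR a he.1 b he.2.1 c hf.1 d hf.2.1 (fun h => he.2.2 (h ▸ rfl))
      (fun h => hf.2.2 (h ▸ rfl)) heq
  | succ n hn ih =>
    obtain ⟨f, hf⟩ := exists_card_colorsOn_comp_eq hc
    have hno' : ∀ K : Finset V, #K = r + 2 → ¬ RainbowSet (f ∘ col) K := fun K hK hR =>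
      hno K hK fun a ha b hb c hc d hd hab hcd heq =>
        hR a ha b hb c hc d hd hab hcd (congrArg f heq)
    obtain ⟨v, hv, hvc⟩ := exists_card_colorsOn_sdiff_le hr0 hn hS hf
    have hS₀ : #(S.erase v) = n := by rw [card_erase_of_mem hv, hS, Nat.add_sub_cancel]
    have hc₀ : turanEdges n r + 1 ≤ #(colorsOn (f ∘ col) (S.erase v)) := by
      have h1 := card_sdiff_add_card_eq_card (colorsOn_mono (col := f ∘ col) (erase_subset v S))
      have h2 := turanEdges_succ n hr0
      omega
    obtain ⟨p, hp, hT⟩ := ih hS₀ hno' hc₀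
    have hins := insert_erase hv
    obtain ⟨p', hp', hT'⟩ := exists_equipartitionOn_insert hno' hr (notMem_erase v S)
      (by rw [hS₀]; exact hn) hp hT (by rw [hS₀]; exact hc₀) (by rw [hS₀, hins]; exact hf.ge)
      (by rw [hS₀, hins]; exact hvc)
    rw [hins] at hp' hT'
    exact ⟨p', hp', fun e he g hg heq => hT' he hg (congrArg f heq)⟩

lemma exists_equiv_mod_eq_iff {n : ℕ} {p : Fin n → Fin r} (hp : EquipartitionOn p univ)
    (hpos : ∀ i, 0 < partSize p univ i) :
    ∃ σ : Fin n ≃ Fin n, ∀ a b, p a = p b ↔ (σ a : ℕ) % r = σ b % r := by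
  classical
  let P : Finpartition (univ : Finset (Fin n)) := Finpartition.ofSetoid (Setoid.ker p)
  have hpart : ∀ a, P.part a = ({u | p u = p a} : Finset (Fin n)) := by
    intro a
    ext u
    rw [Finpartition.mem_part_ofSetoid_iff_rel, mem_filter_univ, Setoid.ker_def]
    exact eq_comm
  have hparts : P.parts = univ.image fun i => ({u | p u = i} : Finset (Fin n)) := by
    ext s
    simp only [mem_image, mem_univ, true_and]
    constructor
    · intro hs
      obtain ⟨a, ha⟩ := P.nonempty_of_mem_parts hs
      exact ⟨p a, (hpart a).symm.trans (P.part_eq_of_mem hs ha)⟩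
    · rintro ⟨i, rfl⟩
      obtain ⟨a, ha⟩ := card_pos.1 (hpos i)
      obtain rfl := (mem_filter.1 ha).2
      rw [← hpart]
      exact P.part_mem.2 (mem_univ a)
  have hcard : #P.parts = r := by
    rw [hparts, card_image_of_injective, card_univ, Fintype.card_fin]
    intro i j hij
    obtain ⟨a, ha⟩ := card_pos.1 (hpos i)
    have ha' := (mem_filter.1 ha).2
    have h : a ∈ ({u | p u = j} : Finset (Fin n)) := (Finset.ext_iff.1 hij a).1 ha
    rw [← ha', (mem_filter.1 h).2]
  have hP : P.IsEquipartition := by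
    intro s t hs ht
    rw [hparts] at hs ht
    obtain ⟨i, -, rfl⟩ := mem_image.1 hs
    obtain ⟨j, -, rfl⟩ := mem_image.1 ht
    exact hp i j
  obtain ⟨f, hf⟩ := hP.exists_partPreservingEquiv
  refine ⟨(Equiv.subtypeUnivEquiv mem_univ).symm.trans (f.trans (finCongr (card_fin n))),
    fun a b => ?_⟩
  have h := hf ⟨a, mem_univ a⟩ ⟨b, mem_univ b⟩
  rw [hcard] at h
  refine Iff.trans ?_ h
  rw [hpart, hpart]
  refine ⟨fun h => by rw [h], fun h => ?_⟩
  have ha : a ∈ ({u | p u = p b} : Finset (Fin n)) := by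
    rw [← h]
    exact mem_filter.2 ⟨mem_univ a, rfl⟩
  exact (mem_filter.1 ha).2

end RainbowTuran

/-- If the complete graph on `n ≥ k ≥ 6` vertices is edge-colored with exactly
`t_{n,k-2} + 1` distinct colors and contains no rainbow `K_k`, then it contains
a spanning rainbow copy of the Turán graph `T_{n,k-2}`. -/
theorem stmt_10 (n k : ℕ) (hk : 6 ≤ k) (hkn : k ≤ n)
    (col : Sym2 (Fin n) → ℕ)
    (hc : (col '' (⊤ : SimpleGraph (Fin n)).edgeSet).ncard =
      turanEdges n (k - 2) + 1)
    (hno : ¬ ∃ s : Finset (Fin n), s.card = k ∧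
      IsRainbowClique (⊤ : SimpleGraph (Fin n)) col s) :
    ∃ σ : Fin n ≃ Fin n, Set.InjOn col (turanCopyEdges n (k - 2) σ) := by
  classical
  obtain ⟨r, rfl⟩ := Nat.exists_eq_add_of_le' ((by omega : 2 ≤ 6).trans hk)
  rw [Nat.add_sub_cancel] at hc ⊢
  have hcolors : col '' (⊤ : SimpleGraph (Fin n)).edgeSet =
      (colorsOn col (Finset.univ : Finset (Fin n)) : Set ℕ) := by
    ext c
    rw [Finset.mem_coe, mem_colorsOn]
    constructor
    · rintro ⟨e, he, rfl⟩
      induction e with | _ a b => ?_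
      exact ⟨a, Finset.mem_univ a, b, Finset.mem_univ b,
        SimpleGraph.Adj.ne ((SimpleGraph.mem_edgeSet _).1 he), rfl⟩
    · rintro ⟨a, -, b, -, hab, rfl⟩
      exact ⟨s(a, b), hab, rfl⟩
  rw [hcolors, Set.ncard_coe_finset] at hc
  have hno' : ∀ K : Finset (Fin n), K.card = r + 2 → ¬ RainbowSet col K := fun K hK hR =>
    hno ⟨K, hK, fun _ _ _ _ h => h, fun a ha b hb c hc d hd hab hcd hne heq =>
      hne (hR a ha b hb c hc d hd hab hcd heq)⟩
  obtain ⟨p, hp, hT⟩ := exists_equipartitionOn (by omega) (by omega) (Finset.card_fin n) hno' hc.ge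
  have hpos : ∀ i, 0 < partSize p Finset.univ i := fun i =>
    (Nat.div_pos (by rw [Finset.card_fin]; omega) (by omega)).trans_le (hp.div_le i)
  obtain ⟨σ, hσ⟩ := exists_equiv_mod_eq_iff hp hpos
  refine ⟨σ, hT.mono fun e he => ?_⟩
  induction e with | _ a b => ?_
  exact ⟨Finset.mem_univ a, Finset.mem_univ b, fun h => he ((hσ a b).1 h)⟩
end

section
/- If the complete graph K_n on n ≥ 3 vertices is edge-colored using at least n distinct colors, then it contains a rainbow triangle. -/
/-- A rainbow triangle in an edge-colored graph: three pairwise adjacent vertices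
whose three connecting edges receive pairwise distinct colors. -/
def IsRainbowTriangle {V : Type*} (G : SimpleGraph V) (col : Sym2 V → ℕ)
    (a b c : V) : Prop :=
  G.Adj a b ∧ G.Adj b c ∧ G.Adj a c ∧
    col s(a, b) ≠ col s(b, c) ∧ col s(a, b) ≠ col s(a, c) ∧
    col s(b, c) ≠ col s(a, c)

/-- The set of (vertex sets of) rainbow triangles of an edge-colored graph. -/
def rainbowTriangles {V : Type*} [DecidableEq V] (G : SimpleGraph V)
    (col : Sym2 V → ℕ) : Set (Finset V) :=
  {t | ∃ a b c, t = {a, b, c} ∧ IsRainbowTriangle G col a b c}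

/-- The colors of the edges of the complete graph spanned by `s`. -/
def edgeColors {V : Type*} [DecidableEq V] (col : Sym2 V → ℕ) (s : Finset V) : Finset ℕ :=
  s.offDiag.image fun p => col s(p.1, p.2)

theorem mem_edgeColors {V : Type*} [DecidableEq V] {col : Sym2 V → ℕ} {s : Finset V} {x : ℕ} :
    x ∈ edgeColors col s ↔ ∃ a ∈ s, ∃ b ∈ s, a ≠ b ∧ col s(a, b) = x := by
  simp only [edgeColors, Finset.mem_image, Finset.mem_offDiag, Prod.exists]
  grind

/-- In the absence of rainbow triangles, adding a vertex creates at most one new color. -/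
theorem card_edgeColors_insert_sdiff_le_one {V : Type*} [DecidableEq V] {col : Sym2 V → ℕ}
    (h : ∀ a b c, ¬ IsRainbowTriangle (⊤ : SimpleGraph V) col a b c) (v : V) (s : Finset V) :
    (edgeColors col (insert v s) \ edgeColors col s).card ≤ 1 := by
  have new_edge : ∀ x ∈ edgeColors col (insert v s) \ edgeColors col s,
      ∃ a ∈ s, a ≠ v ∧ col s(v, a) = x := by
    intro x hx
    obtain ⟨hx, hxs⟩ := Finset.mem_sdiff.mp hx
    obtain ⟨a, ha, b, hb, hab, rfl⟩ := mem_edgeColors.mp hx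
    rcases Finset.mem_insert.mp ha with rfl | has
    · exact ⟨b, (Finset.mem_insert.mp hb).resolve_left hab.symm, hab.symm, rfl⟩
    rcases Finset.mem_insert.mp hb with rfl | hbs
    · exact ⟨a, has, hab, by rw [Sym2.eq_swap]⟩
    · exact absurd (mem_edgeColors.mpr ⟨a, has, b, hbs, hab, rfl⟩) hxs
  refine Finset.card_le_one.mpr fun x hx y hy => ?_
  obtain ⟨a, ha, hav, rfl⟩ := new_edge x hx
  obtain ⟨b, hb, hbv, rfl⟩ := new_edge y hy
  by_contra hne
  have hab : a ≠ b := fun e => hne (by rw [e])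
  have hmem : col s(a, b) ∈ edgeColors col s :=
    mem_edgeColors.mpr ⟨a, ha, b, hb, hab, rfl⟩
  refine h v a b ⟨hav.symm, hab, hbv.symm, fun e => ?_, hne, fun e => ?_⟩
  · exact (Finset.mem_sdiff.mp hx).2 (e ▸ hmem)
  · exact (Finset.mem_sdiff.mp hy).2 (e ▸ hmem)

/-- A complete graph without rainbow triangles has fewer colors than vertices. -/
theorem card_edgeColors_lt_card {V : Type*} [DecidableEq V] {col : Sym2 V → ℕ}
    (h : ∀ a b c, ¬ IsRainbowTriangle (⊤ : SimpleGraph V) col a b c) {s : Finset V}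
    (hs : s.Nonempty) : (edgeColors col s).card < s.card := by
  induction hs using Finset.Nonempty.cons_induction with
  | singleton a => simp [edgeColors]
  | cons v s hv hs ih =>
    rw [Finset.card_cons, Finset.cons_eq_insert]
    have := card_edgeColors_insert_sdiff_le_one h v s
    have := Finset.card_le_card_sdiff_add_card
      (s := edgeColors col (insert v s)) (t := edgeColors col s)
    omega

/-- If the complete graph on `n ≥ 3` vertices is edge-colored using at least `n`
distinct colors, then it contains a rainbow triangle. -/
theorem stmt_15 (n : ℕ) (hn : 3 ≤ n) (col : Sym2 (Fin n) → ℕ)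
    (h : n ≤ (col '' (⊤ : SimpleGraph (Fin n)).edgeSet).ncard) :
    ∃ a b c : Fin n, IsRainbowTriangle (⊤ : SimpleGraph (Fin n)) col a b c := by
  by_contra! hno
  have heq : col '' (⊤ : SimpleGraph (Fin n)).edgeSet = edgeColors col Finset.univ := by
    ext x
    simp only [Set.mem_image, Sym2.exists, SimpleGraph.mem_edgeSet, SimpleGraph.top_adj,
      Finset.mem_coe, mem_edgeColors, Finset.mem_univ, true_and]
  have hlt := card_edgeColors_lt_card hno (s := Finset.univ) ⟨⟨0, by omega⟩, Finset.mem_univ _⟩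
  rw [heq, Set.ncard_coe_finset] at h
  rw [Finset.card_univ, Fintype.card_fin] at hlt
  omega
end
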